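/- arXiv:1607.02259 — 2 statements merged into one kernel-verified Lean document; each statement's English description precedes it below -/
import Mathlib

section
/- The von Neumann entropy is strictly concave on positive definite real symmetric matrices: if A and B are n × n positive definite symmetric real matrices with A ≠ B, and t ∈ (0, 1), then H(t•A + (1−t)•B) > t·H(A) + (1−t)·H(B), where H(M) = −Tr(M * log M) and log M is defined by applying the real logarithm to the eigenvalues in a spectral decomposition of M. -/
open Matrix

variable {n : ℕ}

/-- The matrix logarithm of a real symmetric matrix, obtained by applying the
real logarithm to the eigenvalues in a spectral decomposition (junk value `0`
if the matrix is not symmetric/Hermitian). -/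
noncomputable def matLog (M : Matrix (Fin n) (Fin n) ℝ) : Matrix (Fin n) (Fin n) ℝ :=
  if h : M.IsHermitian then h.cfc Real.log else 0

/-- The von Neumann entropy `H(M) = -Tr (M * log M)` of a real symmetric matrix. -/
noncomputable def vnEntropy (M : Matrix (Fin n) (Fin n) ℝ) : ℝ :=
  -(M * matLog M).trace

theorem vn_spec (A : Matrix (Fin n) (Fin n) ℝ) (hA : A.PosDef) :
    ∃ (U : Matrix (Fin n) (Fin n) ℝ) (a : Fin n → ℝ), U * Uᵀ = 1 ∧ Uᵀ * U = 1 ∧ (∀ i, 0 < a i) ∧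
      A = U * diagonal a * Uᵀ ∧ matLog A = U * diagonal (fun i => Real.log (a i)) * Uᵀ := by
  have h := hA.isHermitian
  refine ⟨h.eigenvectorUnitary, h.eigenvalues, ?_, ?_, hA.eigenvalues_pos, ?_, ?_⟩
  · have := Unitary.coe_mul_star_self h.eigenvectorUnitary
    simpa [star_eq_conjTranspose, conjTranspose_eq_transpose_of_trivial] using this
  · have := Unitary.coe_star_mul_self h.eigenvectorUnitary
    simpa [star_eq_conjTranspose, conjTranspose_eq_transpose_of_trivial] using this
  · have := h.spectral_theorem
    rw [Unitary.conjStarAlgAut_apply, star_eq_conjTranspose,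
      conjTranspose_eq_transpose_of_trivial] at this
    exact this
  · rw [matLog, dif_pos h, Matrix.IsHermitian.cfc, Unitary.conjStarAlgAut_apply,
      star_eq_conjTranspose, conjTranspose_eq_transpose_of_trivial]
    rfl

theorem vn_tr (U V : Matrix (Fin n) (Fin n) ℝ) (a c : Fin n → ℝ) :
    ((U * diagonal a * Uᵀ) * (V * diagonal c * Vᵀ)).trace
      = ∑ i, ∑ j, ((Uᵀ * V) i j) ^ 2 * (a i * c j) := by
  have h1 : ((U * diagonal a * Uᵀ) * (V * diagonal c * Vᵀ)).trace
      = (diagonal a * ((Uᵀ * V) * diagonal c * (Uᵀ * V)ᵀ)).trace := by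
    rw [mul_assoc U, mul_assoc U, trace_mul_comm]
    simp only [transpose_mul, transpose_transpose, mul_assoc]
  rw [h1]
  generalize Uᵀ * V = W
  simp only [trace, diag_apply, diagonal_mul]
  refine Finset.sum_congr rfl fun i _ => ?_
  rw [mul_apply, Finset.mul_sum]
  refine Finset.sum_congr rfl fun j _ => ?_
  rw [mul_diagonal, transpose_apply]
  ring

theorem vn_scalar (a c : ℝ) (ha : 0 < a) (hc : 0 < c) :
    0 ≤ a * Real.log a - a * Real.log c - a + c ∧
    (a * Real.log a - a * Real.log c - a + c = 0 → a = c) := by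
  have key : a ≠ c → 0 < a * Real.log a - a * Real.log c - a + c := by
    intro hne
    have h1 := Real.log_lt_sub_one_of_pos (div_pos hc ha)
      (fun h => hne ((div_eq_one_iff_eq ha.ne').1 h).symm)
    rw [Real.log_div hc.ne' ha.ne'] at h1
    have h2 := mul_lt_mul_of_pos_left h1 ha
    have h3 : a * (c / a - 1) = c - a := by field_simp
    rw [h3] at h2
    linarith
  by_cases h : a = c
  · subst h; simp
  · exact ⟨(key h).le, fun h0 => absurd h0 (key h).ne'⟩

/-- Klein's inequality with its equality case. -/
theorem vn_klein (A C : Matrix (Fin n) (Fin n) ℝ) (hA : A.PosDef) (hC : C.PosDef) :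
    0 ≤ (A * matLog A).trace - (A * matLog C).trace - A.trace + C.trace ∧
    ((A * matLog A).trace - (A * matLog C).trace - A.trace + C.trace = 0 → A = C) := by
  obtain ⟨U, a, hU, hU', ha, hAe, hAl⟩ := vn_spec A hA
  obtain ⟨V, c, hV, hV', hc, hCe, hCl⟩ := vn_spec C hC
  have oneU : (1 : Matrix (Fin n) (Fin n) ℝ) = U * diagonal (fun _ => 1) * Uᵀ := by
    simp [hU]
  have oneV : (1 : Matrix (Fin n) (Fin n) ℝ) = V * diagonal (fun _ => 1) * Vᵀ := by
    simp [hV]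
  have e1 : (A * matLog A).trace
      = ∑ i, ∑ j, ((Uᵀ * V) i j) ^ 2 * (a i * Real.log (a i)) := by
    have : A * matLog A = (U * diagonal (fun i => a i * Real.log (a i)) * Uᵀ) *
        (V * diagonal (fun _ => 1) * Vᵀ) := by
      rw [← oneV, mul_one, hAl, ← diagonal_mul_diagonal]
      conv_lhs => rw [hAe]
      calc _ = U * diagonal a * (Uᵀ * U) * diagonal (fun i => Real.log (a i)) * Uᵀ := by
            simp only [mul_assoc]
        _ = _ := by rw [hU', mul_one]; simp only [mul_assoc]
    rw [this, vn_tr]; simp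
  have e2 : (A * matLog C).trace
      = ∑ i, ∑ j, ((Uᵀ * V) i j) ^ 2 * (a i * Real.log (c j)) := by
    rw [hCl]; conv_lhs => rw [hAe]
    rw [vn_tr]
  have e3 : A.trace = ∑ i, ∑ j, ((Uᵀ * V) i j) ^ 2 * a i := by
    have : A = (U * diagonal a * Uᵀ) * (V * diagonal (fun _ => 1) * Vᵀ) := by
      rw [← oneV, mul_one]; exact hAe
    conv_lhs => rw [this]
    rw [vn_tr]; simp
  have e4 : C.trace = ∑ i, ∑ j, ((Uᵀ * V) i j) ^ 2 * c j := by
    have : C = (U * diagonal (fun _ => 1) * Uᵀ) * (V * diagonal c * Vᵀ) := by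
      rw [← oneU, one_mul]; exact hCe
    conv_lhs => rw [this]
    rw [vn_tr]; simp
  have e : (A * matLog A).trace - (A * matLog C).trace - A.trace + C.trace
      = ∑ i, ∑ j, ((Uᵀ * V) i j) ^ 2 *
        (a i * Real.log (a i) - a i * Real.log (c j) - a i + c j) := by
    rw [e1, e2, e3, e4]
    simp only [← Finset.sum_sub_distrib, ← Finset.sum_add_distrib]
    refine Finset.sum_congr rfl fun i _ => Finset.sum_congr rfl fun j _ => ?_
    ring
  have nn : ∀ i j, 0 ≤ ((Uᵀ * V) i j) ^ 2 *
        (a i * Real.log (a i) - a i * Real.log (c j) - a i + c j) := fun i j =>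
    mul_nonneg (sq_nonneg _) (vn_scalar _ _ (ha i) (hc j)).1
  rw [e]
  refine ⟨Finset.sum_nonneg fun i _ => Finset.sum_nonneg fun j _ => nn i j, fun h0 => ?_⟩
  have z : ∀ i j, ((Uᵀ * V) i j) ^ 2 *
        (a i * Real.log (a i) - a i * Real.log (c j) - a i + c j) = 0 := by
    intro i j
    have h1 := (Finset.sum_eq_zero_iff_of_nonneg
      (fun i _ => Finset.sum_nonneg fun j _ => nn i j)).1 h0 i (Finset.mem_univ i)
    exact (Finset.sum_eq_zero_iff_of_nonneg (fun j _ => nn i j)).1 h1 j (Finset.mem_univ j)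
  have comm : diagonal a * (Uᵀ * V) = (Uᵀ * V) * diagonal c := by
    ext i j
    rw [diagonal_mul, mul_diagonal]
    rcases mul_eq_zero.1 (z i j) with h | h
    · rw [pow_eq_zero_iff two_ne_zero] at h
      rw [h]; simp
    · rw [(vn_scalar _ _ (ha i) (hc j)).2 h, mul_comm]
  calc A = U * (diagonal a * (Uᵀ * V)) * Vᵀ := by
        rw [hAe]
        simp only [mul_assoc, hV, mul_one]
    _ = (U * Uᵀ) * (V * diagonal c * Vᵀ) := by rw [comm]; simp only [mul_assoc]
    _ = C := by rw [hU, one_mul, ← hCe]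

/-- Strict concavity of the von Neumann entropy on positive definite real
symmetric matrices. -/
theorem vnEntropy_strictConcave_real
    (A B : Matrix (Fin n) (Fin n) ℝ) (hA : A.PosDef) (hB : B.PosDef)
    (hAB : A ≠ B) (t : ℝ) (ht0 : 0 < t) (ht1 : t < 1) :
    t * vnEntropy A + (1 - t) * vnEntropy B < vnEntropy (t • A + (1 - t) • B) := by
  have h1t : 0 < 1 - t := by linarith
  have hC : (t • A + (1 - t) • B).PosDef := (hA.smul ht0).add (hB.smul h1t)
  have kA := vn_klein A _ hA hC
  have kB := vn_klein B _ hB hC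
  have hne : A ≠ t • A + (1 - t) • B := by
    intro h
    apply hAB
    have h2 : (1 - t) • (A - B) = 0 := by
      have h3 : (1 - t) • (A - B) = A - (t • A + (1 - t) • B) := by module
      rw [h3, ← h, sub_self]
    exact sub_eq_zero.1 ((smul_eq_zero.1 h2).resolve_left h1t.ne')
  have sA := lt_of_le_of_ne kA.1 (fun h => hne (kA.2 h.symm))
  have sB := kB.1
  have hl : ((t • A + (1 - t) • B) * matLog (t • A + (1 - t) • B)).trace
      = t * (A * matLog (t • A + (1 - t) • B)).trace
        + (1 - t) * (B * matLog (t • A + (1 - t) • B)).trace := by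
    rw [add_mul, trace_add, smul_mul, smul_mul, trace_smul, trace_smul, smul_eq_mul, smul_eq_mul]
  have ht : (t • A + (1 - t) • B).trace = t * A.trace + (1 - t) * B.trace := by
    rw [trace_add, trace_smul, trace_smul, smul_eq_mul, smul_eq_mul]
  simp only [vnEntropy]
  rw [hl]
  rw [ht] at sA sB
  have q1 := mul_pos ht0 sA
  have q2 := mul_nonneg h1t.le sB
  linarith
end

section
/- Kullback–Leibler divergence is invariant under sufficient stochastic maps: let p, q : Fin n → ℝ be probability vectors with the support of p contained in the support of q. Let M be an n × m matrix and N an m × n matrix, both with nonnegative entries and all row sums equal to 1 (row-stochastic), defining channels T(u)_j = ∑_i u_i M_{ij} and S(v)_i = ∑_j v_j N_{ji}. If S(T(p)) = p and S(T(q)) = q, then D(T(p) ‖ T(q)) = D(p ‖ q). -/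
/-- Kullback–Leibler divergence of two vectors indexed by `Fin k`:
`D(u‖v) = ∑_{i : u i > 0} u i * ln (u i / v i)`. -/
noncomputable def KLdiv {k : ℕ} (u v : Fin k → ℝ) : ℝ :=
  ∑ i ∈ Finset.univ.filter (fun i => 0 < u i), u i * Real.log (u i / v i)

/-- A matrix is row-stochastic if its entries are nonnegative and each row sums
to `1`. -/
def RowStochastic {k l : ℕ} (M : Matrix (Fin k) (Fin l) ℝ) : Prop :=
  (∀ i j, 0 ≤ M i j) ∧ ∀ i, ∑ j, M i j = 1

/-- The channel on probability vectors determined by a row-stochastic matrix. -/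
def channel {k l : ℕ} (M : Matrix (Fin k) (Fin l) ℝ) (p : Fin k → ℝ) : Fin l → ℝ :=
  fun j => ∑ i, p i * M i j

lemma KLdiv_eq_sum {k : ℕ} (u v : Fin k → ℝ) (hu : ∀ i, 0 ≤ u i) :
    KLdiv u v = ∑ i, u i * Real.log (u i / v i) := by
  unfold KLdiv
  apply Finset.sum_subset (Finset.filter_subset _ _)
  intro i _ hi
  have h0 : u i = 0 := by
    simp only [Finset.mem_filter, Finset.mem_univ, true_and, not_lt] at hi
    exact le_antisymm hi (hu i)
  simp [h0]

lemma channel_nonneg {k l : ℕ} (M : Matrix (Fin k) (Fin l) ℝ) (hM : RowStochastic M)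
    (p : Fin k → ℝ) (hp : ∀ i, 0 ≤ p i) (j : Fin l) : 0 ≤ channel M p j :=
  Finset.sum_nonneg fun i _ => mul_nonneg (hp i) (hM.1 i j)

lemma channel_pos {k l : ℕ} (M : Matrix (Fin k) (Fin l) ℝ) (hM : RowStochastic M)
    (p : Fin k → ℝ) (hp : ∀ i, 0 ≤ p i) (i : Fin k) (j : Fin l)
    (h1 : 0 < p i) (h2 : 0 < M i j) : 0 < channel M p j :=
  lt_of_lt_of_le (mul_pos h1 h2)
    (Finset.single_le_sum (f := fun i => p i * M i j)
      (fun i _ => mul_nonneg (hp i) (hM.1 i j)) (Finset.mem_univ i))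

/-- Data processing inequality. -/
lemma KLdiv_channel_le {k l : ℕ} (M : Matrix (Fin k) (Fin l) ℝ) (hM : RowStochastic M)
    (p q : Fin k → ℝ) (hp : ∀ i, 0 ≤ p i) (hq : ∀ i, 0 ≤ q i)
    (hs : ∀ i, 0 < p i → 0 < q i) :
    KLdiv (channel M p) (channel M q) ≤ KLdiv p q := by
  rw [KLdiv_eq_sum _ _ hp, KLdiv_eq_sum _ _ (channel_nonneg M hM p hp)]
  set P := channel M p with hP
  set Q := channel M q with hQ
  have hP0 : ∀ j, 0 ≤ P j := channel_nonneg M hM p hp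
  have hQ0 : ∀ j, 0 ≤ Q j := channel_nonneg M hM q hq
  have key : ∀ i j, p i * M i j - q i * M i j * (P j / Q j) ≤
      p i * Real.log (p i / q i) * M i j - p i * M i j * Real.log (P j / Q j) := by
    intro i j
    rcases (hM.1 i j).eq_or_lt with h | hMij
    · simp [← h]
    rcases (hp i).eq_or_lt with h | hpi
    · have := mul_nonneg (mul_nonneg (hq i) hMij.le) (div_nonneg (hP0 j) (hQ0 j))
      simp only [← h]
      linarith
    have hqi := hs i hpi
    have hPj : 0 < P j := channel_pos M hM p hp i j hpi hMij
    have hQj : 0 < Q j := channel_pos M hM q hq i j hqi hMij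
    have hx : 0 < (P j / Q j) / (p i / q i) := by positivity
    have hl := Real.log_le_sub_one_of_pos hx
    rw [Real.log_div (by positivity) (by positivity)] at hl
    have h2 := mul_le_mul_of_nonneg_left hl (mul_pos hpi hMij).le
    have h3 : p i * M i j * ((P j / Q j) / (p i / q i) - 1)
        = q i * M i j * (P j / Q j) - p i * M i j := by
      field_simp
    rw [h3] at h2
    linarith
  have hsum : ∑ j, ∑ i, (p i * M i j - q i * M i j * (P j / Q j)) ≤
      ∑ j, ∑ i, (p i * Real.log (p i / q i) * M i j - p i * M i j * Real.log (P j / Q j)) :=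
    Finset.sum_le_sum fun j _ => Finset.sum_le_sum fun i _ => key i j
  have hL : 0 ≤ ∑ j, ∑ i, (p i * M i j - q i * M i j * (P j / Q j)) := by
    apply Finset.sum_nonneg
    intro j _
    rw [Finset.sum_sub_distrib, ← Finset.sum_mul]
    change 0 ≤ P j - Q j * (P j / Q j)
    rcases (hQ0 j).eq_or_lt with h | h
    · simpa [← h] using hP0 j
    · rw [mul_div_cancel₀ _ h.ne']
      simp
  have hR : ∑ j, ∑ i, (p i * Real.log (p i / q i) * M i j - p i * M i j * Real.log (P j / Q j))
      = ∑ i, p i * Real.log (p i / q i) - ∑ j, P j * Real.log (P j / Q j) := by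
    simp only [Finset.sum_sub_distrib]
    congr 1
    · rw [Finset.sum_comm]
      refine Finset.sum_congr rfl fun i _ => ?_
      rw [← Finset.mul_sum, hM.2 i, mul_one]
    · refine Finset.sum_congr rfl fun j _ => ?_
      rw [← Finset.sum_mul]
      rfl
  linarith

/-- Kullback–Leibler divergence is invariant under sufficient stochastic maps:
if the channel `T` given by `M` can be reversed on `p` and `q` by the channel
`S` given by `N`, then `D(T p ‖ T q) = D(p ‖ q)`. -/
theorem kl_invariant_sufficient {n m : ℕ} (p q : Fin n → ℝ)
    (hp : (∀ i, 0 ≤ p i) ∧ ∑ i, p i = 1)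
    (hq : (∀ i, 0 ≤ q i) ∧ ∑ i, q i = 1)
    (hsupp : Function.support p ⊆ Function.support q)
    (M : Matrix (Fin n) (Fin m) ℝ) (N : Matrix (Fin m) (Fin n) ℝ)
    (hM : RowStochastic M) (hN : RowStochastic N)
    (hrecp : channel N (channel M p) = p)
    (hrecq : channel N (channel M q) = q) :
    KLdiv (channel M p) (channel M q) = KLdiv p q := by
  have hs : ∀ i, 0 < p i → 0 < q i := fun i h =>
    lt_of_le_of_ne (hq.1 i) (Ne.symm (hsupp (Function.mem_support.mpr h.ne')))
  apply le_antisymm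
  · exact KLdiv_channel_le M hM p q hp.1 hq.1 hs
  · have h := KLdiv_channel_le N hN (channel M p) (channel M q)
      (channel_nonneg M hM p hp.1) (channel_nonneg M hM q hq.1) (by
        intro j hj
        obtain ⟨i, _, hi⟩ := Finset.exists_lt_of_sum_lt (s := Finset.univ)
          (f := fun _ : Fin n => (0 : ℝ)) (g := fun i => p i * M i j) (by simpa [channel] using hj)
        have hpi : 0 < p i := lt_of_le_of_ne (hp.1 i) (by
          intro h
          simp [← h] at hi)
        have hMi : 0 < M i j := lt_of_le_of_ne (hM.1 i j) (by
          intro h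
          simp [← h] at hi)
        exact channel_pos M hM q hq.1 i j (hs i hpi) hMi)
    rwa [hrecp, hrecq] at h
end
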